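/- arXiv:2206.12535 — 2 statements merged into one kernel-verified Lean document; each statement's English description precedes it below -/
import Mathlib

section
/- For all n ≥ 2, the number R_{n,2} of product-free 2-element subsets of {1,...,n} satisfies R_{n,2} = C(n,2) - n - ⌊√n⌋ + 2 (an identity of integers), where C(n,2) = n(n-1)/2. -/
/-- A set of positive integers is product-free if the product of any two
(not necessarily distinct) elements is not in the set. -/
def ProductFree (S : Finset ℕ) : Prop := ∀ i ∈ S, ∀ j ∈ S, i * j ∉ S

/-- A pair `a < b` of positive integers is product-free iff `a ≠ 1` and `b` is not `a ^ 2`. -/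
lemma productFree_pair_iff {a b : ℕ} (ha : 1 ≤ a) (hab : a < b) :
    ProductFree {a, b} ↔ 2 ≤ a ∧ b ≠ a * a := by
  constructor
  · intro h
    have haa := h a (by simp) a (by simp)
    simp only [Finset.mem_insert, Finset.mem_singleton, not_or] at haa
    refine ⟨?_, fun hb => haa.2 hb.symm⟩
    by_contra h2
    obtain rfl : a = 1 := by omega
    simp at haa
  · rintro ⟨h2, hb⟩ i hi j hj
    simp only [Finset.mem_insert, Finset.mem_singleton, not_or] at hi hj ⊢
    rcases hi with rfl | rfl <;> rcases hj with rfl | rfl <;> constructor <;>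
      first
        | exact fun h => hb h.symm
        | (intro h; nlinarith)

/-- The map `a ↦ {a, a ^ 2}` is injective on integers at least `2`. -/
lemma pair_mul_self_injOn (m : ℕ) :
    Set.InjOn (fun a : ℕ => ({a, a * a} : Finset ℕ)) (Finset.Icc 2 m : Finset ℕ) := by
  intro a ha b hb h
  simp only [Finset.coe_Icc, Set.mem_Icc] at ha hb
  dsimp only at h
  have h₁ : a ∈ ({b, b * b} : Finset ℕ) := by rw [← h]; simp
  have h₂ : b ∈ ({a, a * a} : Finset ℕ) := by rw [h]; simp
  simp only [Finset.mem_insert, Finset.mem_singleton] at h₁ h₂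
  rcases h₁ with h₁ | h₁
  · exact h₁
  rcases h₂ with h₂ | h₂
  · exact h₂.symm
  nlinarith

/-- The product-free pairs in `{1, …, n}` are the pairs in `{2, …, n}` other than `{a, a ^ 2}`. -/
lemma setOf_productFree_pairs (n : ℕ) :
    {S : Finset ℕ | S ⊆ Finset.Icc 1 n ∧ S.card = 2 ∧ ProductFree S} =
      ((Finset.Icc 2 n).powersetCard 2 \
        (Finset.Icc 2 n.sqrt).image (fun a => ({a, a * a} : Finset ℕ)) : Finset (Finset ℕ)) := by
  ext S
  simp only [Set.mem_ofPred_eq, Finset.coe_sdiff, Set.mem_sdiff, Finset.mem_coe,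
    Finset.mem_powersetCard, Finset.mem_image, Finset.mem_Icc]
  constructor
  · rintro ⟨hS, hc, hf⟩
    refine ⟨⟨fun x hx => ?_, hc⟩, ?_⟩
    · have hx1 := Finset.mem_Icc.1 (hS hx)
      have : x ≠ 1 := by rintro rfl; exact hf 1 hx 1 hx hx
      exact Finset.mem_Icc.2 (by omega)
    · rintro ⟨a, -, rfl⟩
      exact hf a (by simp) a (by simp) (by simp)
  · rintro ⟨⟨hS, hc⟩, hsq⟩
    refine ⟨hS.trans (Finset.Icc_subset_Icc_left (by norm_num)), hc, ?_⟩
    obtain ⟨a, b, hab, rfl⟩ : ∃ a b, a < b ∧ S = {a, b} := by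
      obtain ⟨a, b, hne, rfl⟩ := Finset.card_eq_two.1 hc
      rcases hne.lt_or_gt with h | h
      · exact ⟨a, b, h, rfl⟩
      · exact ⟨b, a, h, Finset.pair_comm a b⟩
    have ha := Finset.mem_Icc.1 (hS (Finset.mem_insert_self a {b}))
    have hb := Finset.mem_Icc.1 (hS (Finset.mem_insert_of_mem (Finset.mem_singleton_self b)))
    refine (productFree_pair_iff (by omega) hab).2 ⟨ha.1, ?_⟩
    rintro rfl
    exact hsq ⟨a, ⟨ha.1, Nat.le_sqrt.2 hb.2⟩, rfl⟩

lemma image_pair_mul_self_subset (n : ℕ) :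
    (Finset.Icc 2 n.sqrt).image (fun a => ({a, a * a} : Finset ℕ)) ⊆
      (Finset.Icc 2 n).powersetCard 2 := by
  intro S hS
  obtain ⟨a, ha, rfl⟩ := Finset.mem_image.1 hS
  obtain ⟨h2, han⟩ := Finset.mem_Icc.1 ha
  have hsq := Nat.le_sqrt.1 han
  have hlt : a < a * a := by nlinarith
  refine Finset.mem_powersetCard.2 ⟨?_, Finset.card_pair hlt.ne⟩
  intro x hx
  simp only [Finset.mem_insert, Finset.mem_singleton] at hx
  rw [Finset.mem_Icc]
  omega

theorem stmt3 (n : ℕ) (hn : 2 ≤ n) :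
    ({S : Finset ℕ | S ⊆ Finset.Icc 1 n ∧ S.card = 2 ∧ ProductFree S}.ncard : ℤ)
      = (n.choose 2 : ℤ) - (n : ℤ) - (Nat.sqrt n : ℤ) + 2 := by
  have hsub := image_pair_mul_self_subset n
  rw [setOf_productFree_pairs, Set.ncard_coe_finset, Finset.card_sdiff_of_subset hsub,
    Nat.cast_sub (Finset.card_le_card hsub), Finset.card_image_of_injOn (pair_mul_self_injOn _),
    Finset.card_powersetCard, Nat.card_Icc, Nat.card_Icc]
  have hsqrt : 1 ≤ n.sqrt := Nat.le_sqrt.2 (by omega)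
  obtain ⟨m, rfl⟩ : ∃ m, n = m + 1 := ⟨n - 1, by omega⟩
  have hchoose : (m + 1).choose 2 = m + m.choose 2 := by
    rw [Nat.choose_succ_succ' m 1, Nat.choose_one_right]
  rw [hchoose, show m + 1 + 1 - 2 = m by omega]
  omega
end

section
/- Let n > 4 be a composite integer. Consider the simple graph whose vertex set is {i : 1 ≤ i ≤ n-1 and gcd(i,n) > 1}, with two distinct vertices i and j adjacent if and only if gcd(i,j) > 1. Then this graph has exactly 2 connected components if n = 2q for some prime q, and exactly 1 connected component otherwise; moreover in the former case the vertex n/2 is isolated. -/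
theorem SimpleGraph.Reachable.exists_adj_of_ne {V : Type*} {G : SimpleGraph V} {v w : V}
    (h : G.Reachable v w) (hne : v ≠ w) : ∃ u, G.Adj v u := by
  obtain ⟨p⟩ := h
  cases p with
  | nil => exact absurd rfl hne
  | cons h _ => exact ⟨_, h⟩

theorem Nat.one_lt_gcd_of_prime_dvd {p a b : ℕ} (hp : p.Prime) (ha : p ∣ a) (hb : p ∣ b)
    (hb0 : 0 < b) : 1 < Nat.gcd a b :=
  hp.one_lt.trans_le (Nat.le_of_dvd (Nat.gcd_pos_of_pos_right _ hb0) (Nat.dvd_gcd ha hb))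

theorem Nat.exists_prime_dvd_of_one_lt_gcd {a b : ℕ} (h : 1 < Nat.gcd a b) :
    ∃ p, p.Prime ∧ p ∣ a ∧ p ∣ b := by
  obtain ⟨p, hp, hd⟩ := Nat.exists_prime_and_dvd h.ne'
  exact ⟨p, hp, hd.trans (Nat.gcd_dvd_left _ _), hd.trans (Nat.gcd_dvd_right _ _)⟩

section

variable {n : ℕ} {G : SimpleGraph {i : ℕ // i ∈ Finset.Icc 1 (n - 1) ∧ 1 < Nat.gcd i n}}

theorem mem_vertices_of_prime_dvd {p i : ℕ} (hp : p.Prime) (hpi : p ∣ i) (hpn : p ∣ n)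
    (hi : 0 < i) (hin : i < n) : i ∈ Finset.Icc 1 (n - 1) ∧ 1 < Nat.gcd i n :=
  ⟨Finset.mem_Icc.2 ⟨hi, by omega⟩, Nat.one_lt_gcd_of_prime_dvd hp hpi hpn (by omega)⟩

theorem reachable_of_common_prime (hG : ∀ i j, G.Adj i j ↔ i ≠ j ∧ 1 < Nat.gcd i.val j.val)
    {p : ℕ} (hp : p.Prime) {i j : {i : ℕ // i ∈ Finset.Icc 1 (n - 1) ∧ 1 < Nat.gcd i n}}
    (hi : p ∣ i.val) (hj : p ∣ j.val) : G.Reachable i j := by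
  by_cases h : i = j
  · exact h ▸ SimpleGraph.Reachable.refl _
  · exact ((hG i j).2 ⟨h, Nat.one_lt_gcd_of_prime_dvd hp hi hj
      (Finset.mem_Icc.1 j.2.1).1⟩).reachable

theorem preconnected_of_ne_two_mul_prime (hn : 0 < n)
    (hG : ∀ i j, G.Adj i j ↔ i ≠ j ∧ 1 < Nat.gcd i.val j.val)
    (h : ¬ ∃ q, q.Prime ∧ n = 2 * q) : G.Preconnected := by
  intro i j
  obtain ⟨p, hp, hpi, hpn⟩ := Nat.exists_prime_dvd_of_one_lt_gcd i.2.2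
  obtain ⟨r, hr, hrj, hrn⟩ := Nat.exists_prime_dvd_of_one_lt_gcd j.2.2
  by_cases hpr : p = r
  · subst hpr
    exact reachable_of_common_prime hG hp hpi hrj
  have hdvd : p * r ∣ n := ((Nat.coprime_primes hp hr).2 hpr).mul_dvd_of_dvd_of_dvd hpn hrn
  rcases (Nat.le_of_dvd hn hdvd).lt_or_eq with hlt | heq
  · have hk := mem_vertices_of_prime_dvd hp (Dvd.intro r rfl) hpn
      (Nat.mul_pos hp.pos hr.pos) hlt
    exact (reachable_of_common_prime hG hp (j := ⟨_, hk⟩) hpi (Dvd.intro r rfl)).trans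
      (reachable_of_common_prime hG hr (Dvd.intro_left p rfl) hrj)
  · have hp2 : p ≠ 2 := fun h2 => h ⟨r, hr, by rw [← heq, h2]⟩
    have hr2 : r ≠ 2 := fun h2 => h ⟨p, hp, by rw [← heq, h2, mul_comm]⟩
    have hp3 : 2 < p := lt_of_le_of_ne hp.two_le hp2.symm
    have hr3 : 2 < r := lt_of_le_of_ne hr.two_le hr2.symm
    have h2p := mem_vertices_of_prime_dvd (i := 2 * p) hp (Dvd.intro_left 2 rfl) hpn
      (by omega) (by nlinarith)
    have h2r := mem_vertices_of_prime_dvd (i := 2 * r) hr (Dvd.intro_left 2 rfl) hrn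
      (by omega) (by nlinarith)
    exact ((reachable_of_common_prime hG hp (j := ⟨_, h2p⟩) hpi (Dvd.intro_left 2 rfl)).trans
      (reachable_of_common_prime hG Nat.prime_two (j := ⟨_, h2r⟩)
        (Dvd.intro p rfl) (Dvd.intro r rfl))).trans
      (reachable_of_common_prime hG hr (Dvd.intro_left 2 rfl) hrj)

end

theorem Nat.eq_of_dvd_of_pos_of_lt_two_mul {q i : ℕ} (hd : q ∣ i) (hi : 0 < i) (hlt : i < 2 * q) :
    i = q := by
  obtain ⟨k, rfl⟩ := hd
  have hk : k < 2 := by nlinarith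
  interval_cases k <;> omega

theorem stmt17 (n : ℕ) (hn : 4 < n) (hcomp : ¬ n.Prime)
    (G : SimpleGraph {i : ℕ // i ∈ Finset.Icc 1 (n - 1) ∧ 1 < Nat.gcd i n})
    (hG : ∀ i j, G.Adj i j ↔ i ≠ j ∧ 1 < Nat.gcd i.val j.val) :
    ((∃ q, q.Prime ∧ n = 2 * q) →
      Nat.card G.ConnectedComponent = 2 ∧
      ∀ v : {i : ℕ // i ∈ Finset.Icc 1 (n - 1) ∧ 1 < Nat.gcd i n},
        v.val = n / 2 → ∀ w, ¬ G.Adj v w) ∧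
    (¬ (∃ q, q.Prime ∧ n = 2 * q) → Nat.card G.ConnectedComponent = 1) := by
  constructor
  · rintro ⟨q, hq, rfl⟩
    have eq_q : ∀ w : {i : ℕ // i ∈ Finset.Icc 1 (2 * q - 1) ∧ 1 < Nat.gcd i (2 * q)},
        q ∣ w.val → w.val = q := fun w hw => by
      have hw' := Finset.mem_Icc.1 w.2.1
      exact Nat.eq_of_dvd_of_pos_of_lt_two_mul hw hw'.1 (by omega)
    have isolated : ∀ v : {i : ℕ // i ∈ Finset.Icc 1 (2 * q - 1) ∧ 1 < Nat.gcd i (2 * q)},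
        v.val = 2 * q / 2 → ∀ w, ¬ G.Adj v w := by
      intro v hv w hvw
      rw [Nat.mul_div_cancel_left q two_pos] at hv
      obtain ⟨hne, hgcd⟩ := (hG v w).1 hvw
      obtain ⟨p, hp, hpv, hpw⟩ := Nat.exists_prime_dvd_of_one_lt_gcd hgcd
      rw [hv, Nat.prime_dvd_prime_iff_eq hp hq] at hpv
      exact hne (Subtype.ext (hv.trans (eq_q w (hpv ▸ hpw)).symm))
    refine ⟨?_, isolated⟩
    have h2 := mem_vertices_of_prime_dvd (n := 2 * q) Nat.prime_two dvd_rfl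
      (Dvd.intro q rfl) two_pos (by omega)
    have hqv := mem_vertices_of_prime_dvd (n := 2 * q) hq dvd_rfl (Dvd.intro_left 2 rfl)
      hq.pos (by omega)
    refine Nat.card_eq_two_iff.2
      ⟨G.connectedComponentMk ⟨q, hqv⟩, G.connectedComponentMk ⟨2, h2⟩, fun h => ?_, ?_⟩
    · obtain ⟨u, hu⟩ := (SimpleGraph.ConnectedComponent.exact h).exists_adj_of_ne
        (fun h => by have := congrArg Subtype.val h; simp only at this; omega)
      exact isolated _ (by simp) u hu
    · refine Set.eq_univ_of_forall fun c => c.ind fun w => ?_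
      obtain ⟨p, hp, hpw, hpn⟩ := Nat.exists_prime_dvd_of_one_lt_gcd w.2.2
      rcases (hp.dvd_mul).1 hpn with h | h
      · rw [Nat.prime_dvd_prime_iff_eq hp Nat.prime_two] at h
        exact Or.inr (SimpleGraph.ConnectedComponent.sound
          (reachable_of_common_prime hG Nat.prime_two (h ▸ hpw) dvd_rfl))
      · rw [Nat.prime_dvd_prime_iff_eq hp hq] at h
        exact Or.inl (SimpleGraph.ConnectedComponent.sound
          (reachable_of_common_prime hG hq (h ▸ hpw) dvd_rfl))
  · intro h
    have hv := mem_vertices_of_prime_dvd (Nat.minFac_prime (by omega)) dvd_rfl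
      (Nat.minFac_dvd n) (Nat.minFac_pos n)
      ((Nat.not_prime_iff_minFac_lt (by omega)).1 hcomp)
    have := (preconnected_of_ne_two_mul_prime (by omega) hG h).subsingleton_connectedComponent
    exact Nat.card_eq_one_iff_unique.2 ⟨this, ⟨G.connectedComponentMk ⟨_, hv⟩⟩⟩
end
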